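/- arXiv:2603.27196 — 2 statements merged into one kernel-verified Lean document; each statement's English description precedes it below -/
import Mathlib

section
/- Let B > 0, let V : ℝ² → ℝ be continuously differentiable, and let b ∈ ℝ. Assume the sublevel set {(x, y) ∈ ℝ² : x + V(x, y) ≤ b} equals G^int ∪ G^ext, where G^int is compact, G^ext is closed, and G^int ∩ G^ext = ∅. If γ(t) = (x(t), y(t), ξ(t), η(t)) is a Hamiltonian trajectory defined on an interval I containing 0, with p(γ(0)) ≤ b and (x(0), y(0)) ∈ G^int, then (x(t), y(t)) ∈ G^int for every t ∈ I. -/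
/-- The classical Hamiltonian of the magnetic Stark Hamiltonian:
`p(x, y, ξ, η) = (1/2)(ξ + By)² + (1/2)η² + x + V(x, y)`. -/
noncomputable def hamSymbol (B : ℝ) (V : ℝ × ℝ → ℝ) (x y ξ η : ℝ) : ℝ :=
  (ξ + B * y) ^ 2 / 2 + η ^ 2 / 2 + x + V (x, y)

/-- If the sublevel set `{x + V ≤ b}` splits into a compact well `G^int` and a
disjoint closed exterior `G^ext`, then any Hamiltonian trajectory on an interval
`I ∋ 0` with energy `p(γ(0)) ≤ b` starting in the well stays in the well. -/
theorem trajectory_stays_in_well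
    (B : ℝ) (hB : 0 < B) (V : ℝ × ℝ → ℝ) (hV : ContDiff ℝ 1 V) (b : ℝ)
    (Gint Gext : Set (ℝ × ℝ))
    (hGint : IsCompact Gint) (hGext : IsClosed Gext)
    (hdisj : Gint ∩ Gext = ∅)
    (hsub : {z : ℝ × ℝ | z.1 + V z ≤ b} = Gint ∪ Gext)
    (I : Set ℝ) (hI : Convex ℝ I) (h0 : (0 : ℝ) ∈ I)
    (x y ξ η : ℝ → ℝ)
    (hx : ∀ t ∈ I, HasDerivAt x (ξ t + B * y t) t)
    (hy : ∀ t ∈ I, HasDerivAt y (η t) t)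
    (hξ : ∀ t ∈ I, HasDerivAt ξ (-1 - fderiv ℝ V (x t, y t) (1, 0)) t)
    (hη : ∀ t ∈ I,
      HasDerivAt η (-B * (ξ t + B * y t) - fderiv ℝ V (x t, y t) (0, 1)) t)
    (hE : hamSymbol B V (x 0) (y 0) (ξ 0) (η 0) ≤ b)
    (hstart : (x 0, y 0) ∈ Gint) :
    ∀ t ∈ I, (x t, y t) ∈ Gint := by
  have hVd : Differentiable ℝ V := hV.differentiable (by norm_num)
  have hder : ∀ t ∈ I, HasDerivAt
      (fun t => hamSymbol B V (x t) (y t) (ξ t) (η t)) 0 t := by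
    intro t ht
    have hxy : HasDerivAt (fun t => (x t, y t)) (ξ t + B * y t, η t) t :=
      (hx t ht).prodMk (hy t ht)
    have hVt : HasDerivAt (fun t => V (x t, y t))
        (fderiv ℝ V (x t, y t) (ξ t + B * y t, η t)) t :=
      (hVd (x t, y t)).hasFDerivAt.comp_hasDerivAt t hxy
    have hlin : fderiv ℝ V (x t, y t) (ξ t + B * y t, η t)
        = (ξ t + B * y t) * fderiv ℝ V (x t, y t) (1, 0)
          + η t * fderiv ℝ V (x t, y t) (0, 1) := by
      have : ((ξ t + B * y t, η t) : ℝ × ℝ)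
          = (ξ t + B * y t) • ((1, 0) : ℝ × ℝ) + η t • ((0, 1) : ℝ × ℝ) := by
        ext <;> simp
      rw [this, map_add, map_smul, map_smul, smul_eq_mul, smul_eq_mul]
    have h := (((((hξ t ht).add ((hy t ht).const_mul B)).pow 2).div_const 2).add
      (((hη t ht).pow 2).div_const 2)).add (hx t ht) |>.add hVt
    rw [hlin] at h
    unfold hamSymbol
    refine h.congr_deriv ?_
    simp only [Pi.add_apply]
    push_cast
    ring
  have hconst : ∀ t ∈ I, hamSymbol B V (x t) (y t) (ξ t) (η t)
      = hamSymbol B V (x 0) (y 0) (ξ 0) (η 0) := by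
    intro t ht
    have h := hI.norm_image_sub_le_of_norm_hasDerivWithin_le (C := 0)
      (fun s hs => (hder s hs).hasDerivWithinAt) (fun s _ => by simp) h0 ht
    rw [zero_mul] at h
    exact sub_eq_zero.mp (norm_le_zero_iff.mp h)
  have hmem : ∀ t ∈ I, (x t, y t) ∈ Gint ∪ Gext := by
    intro t ht
    rw [← hsub]
    have h := (hconst t ht).trans_le hE
    unfold hamSymbol at h
    change x t + V (x t, y t) ≤ b
    nlinarith [sq_nonneg (ξ t + B * y t), sq_nonneg (η t)]
  have hcont : ContinuousOn (fun t => (x t, y t)) I := fun t ht =>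
    ((hx t ht).continuousAt.prodMk (hy t ht).continuousAt).continuousWithinAt
  have hpre := hI.isPreconnected.image _ hcont
  intro t ht
  rcases hmem t ht with h | h
  · exact h
  · exfalso
    obtain ⟨z, -, hz⟩ := isPreconnected_closed_iff.mp hpre Gint Gext hGint.isClosed hGext
      (by rintro _ ⟨s, hs, rfl⟩; exact hmem s hs)
      ⟨_, ⟨0, h0, rfl⟩, hstart⟩ ⟨_, ⟨t, ht, rfl⟩, h⟩
    rw [hdisj] at hz
    exact hz
end

section
/- Let B > 0, let V : ℝ² → ℝ be smooth, and fix a < b. Assume {(x, y) ∈ ℝ² : x + V(x, y) ≤ b} = G^int ∪ G^ext with G^int compact, G^ext closed, G^int ∩ G^ext = ∅, and assume K_{[a,b]} ∩ {(x, y, ξ, η) : (x, y) ∈ G^ext} = ∅. Then K_{[a,b]} = {(x, y, ξ, η) ∈ ℝ⁴ : (x, y) ∈ G^int and a ≤ p(x, y, ξ, η) ≤ b}. In particular, for every point z₀ = (x₀, y₀, ξ₀, η₀) with (x₀, y₀) ∈ G^int and a ≤ p(z₀) ≤ b, there exists a Hamiltonian trajectory through z₀ defined for all t ∈ ℝ whose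 position component stays in G^int for all time. -/
/-- `(x, y, ξ, η)` is a (global) Hamiltonian trajectory for the magnetic Stark
Hamiltonian: `x' = ξ + By`, `y' = η`, `ξ' = −1 − ∂ₓV`, `η' = −B(ξ + By) − ∂_yV`. -/
def IsHamTrajectory (B : ℝ) (V : ℝ × ℝ → ℝ) (x y ξ η : ℝ → ℝ) : Prop :=
  (∀ t : ℝ, HasDerivAt x (ξ t + B * y t) t) ∧
  (∀ t : ℝ, HasDerivAt y (η t) t) ∧
  (∀ t : ℝ, HasDerivAt ξ (-1 - fderiv ℝ V (x t, y t) (1, 0)) t) ∧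
  (∀ t : ℝ, HasDerivAt η (-B * (ξ t + B * y t) - fderiv ℝ V (x t, y t) (0, 1)) t)

/-- The trapped set `K_{[a,b]}`: points of phase space with energy in `[a, b]`
through which there passes a globally defined Hamiltonian trajectory whose
position component is bounded. -/
def trappedSet (B : ℝ) (V : ℝ × ℝ → ℝ) (a b : ℝ) : Set (ℝ × ℝ × ℝ × ℝ) :=
  {z | a ≤ hamSymbol B V z.1 z.2.1 z.2.2.1 z.2.2.2 ∧
       hamSymbol B V z.1 z.2.1 z.2.2.1 z.2.2.2 ≤ b ∧
       ∃ x y ξ η : ℝ → ℝ, IsHamTrajectory B V x y ξ η ∧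
         x 0 = z.1 ∧ y 0 = z.2.1 ∧ ξ 0 = z.2.2.1 ∧ η 0 = z.2.2.2 ∧
         ∃ C : ℝ, ∀ t : ℝ, ‖(x t, y t)‖ ≤ C}

open Set in
/-- A bounded Lipschitz vector field has global integral curves. -/
lemma exists_global_curve {E : Type*} [NormedAddCommGroup E] [NormedSpace ℝ E] [CompleteSpace E]
    (v : E → E) (K L : NNReal) (hK : LipschitzWith K v) (hL : ∀ z, ‖v z‖ ≤ L) (z : E) :
    ∃ γ : ℝ → E, γ 0 = z ∧ ∀ t, HasDerivAt γ (v (γ t)) t := by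
  have key : ∀ n : NNReal, ∃ γ : ℝ → E, γ 0 = z ∧
      ∀ t ∈ Ioo (-(n : ℝ)) n, HasDerivAt γ (v (γ t)) t := by
    intro n
    have h0 : (0 : ℝ) ∈ Icc (-(n : ℝ)) n := ⟨by simp, n.2⟩
    have hP : IsPicardLindelof (fun _ : ℝ ↦ v) (⟨0, h0⟩ : Icc (-(n : ℝ)) n) z (L * n) 0 L K := by
      apply IsPicardLindelof.of_time_independent (fun x _ ↦ hL x) hK.lipschitzOnWith
      simp
    obtain ⟨γ, h1, h2⟩ := hP.exists_eq_forall_mem_Icc_hasDerivWithinAt₀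
    exact ⟨γ, h1, fun t ht ↦ (h2 t (Ioo_subset_Icc_self ht)).hasDerivAt (Icc_mem_nhds ht.1 ht.2)⟩
  choose γ hγ0 hγ using key
  have uniq : ∀ m n : NNReal, m ≤ n → ∀ t ∈ Ioo (-(m : ℝ)) m, γ m t = γ n t := by
    intro m n hmn t ht
    have hmn' : (m : ℝ) ≤ n := hmn
    have hm : (0 : ℝ) < m := by have := ht.1; have := ht.2; linarith
    refine ODE_solution_unique_of_mem_Ioo (v := fun _ ↦ v) (s := fun _ ↦ univ) (K := K) (t₀ := 0)
      (fun _ _ ↦ hK.lipschitzOnWith) ⟨by linarith, hm⟩ (fun s hs ↦ ⟨hγ m s hs, trivial⟩)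
      (fun s hs ↦ ⟨hγ n s ⟨?_, ?_⟩, trivial⟩) (by rw [hγ0, hγ0]) ht
    · have := hs.1; linarith
    · have := hs.2; linarith
  let N : ℝ → NNReal := fun t ↦ ‖t‖₊ + 1
  have hN : ∀ t, t ∈ Ioo (-(N t : ℝ)) (N t) := by
    intro t
    rw [mem_Ioo, ← abs_lt]
    simp [N]
  refine ⟨fun t ↦ γ (N t) t, hγ0 _, fun t ↦ ?_⟩
  refine (hγ (N t) t (hN t)).congr_of_eventuallyEq ?_
  filter_upwards [Ioo_mem_nhds (hN t).1 (hN t).2] with s hs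
  rcases le_total (N s) (N t) with h | h
  · exact uniq _ _ h s (hN s)
  · exact (uniq _ _ h s hs).symm

/-- The Hamiltonian vector field. -/
noncomputable def hamField (B : ℝ) (V : ℝ × ℝ → ℝ) (z : ℝ × ℝ × ℝ × ℝ) : ℝ × ℝ × ℝ × ℝ :=
  (z.2.2.1 + B * z.2.1, z.2.2.2, -1 - fderiv ℝ V (z.1, z.2.1) (1, 0),
    -B * (z.2.2.1 + B * z.2.1) - fderiv ℝ V (z.1, z.2.1) (0, 1))

lemma hamField_contDiff (B : ℝ) (V : ℝ × ℝ → ℝ) (hV : ContDiff ℝ (⊤ : ℕ∞) V) :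
    ContDiff ℝ 1 (hamField B V) := by
  have h1 : ContDiff ℝ 1 (fderiv ℝ V) := hV.fderiv_right (by norm_cast)
  have h2 : ContDiff ℝ 1 (fun z : ℝ × ℝ × ℝ × ℝ ↦ fderiv ℝ V (z.1, z.2.1)) :=
    h1.comp (by fun_prop)
  unfold hamField
  fun_prop

/-- Bounds for the phase-space points over the well. -/
lemma well_bounded (B : ℝ) (hB : 0 < B) (V : ℝ × ℝ → ℝ) (hV : Continuous V) (b : ℝ)
    (G : Set (ℝ × ℝ)) (hG : IsCompact G) :
    ∃ R > 0, ∀ z : ℝ × ℝ × ℝ × ℝ, (z.1, z.2.1) ∈ G →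
      hamSymbol B V z.1 z.2.1 z.2.2.1 z.2.2.2 ≤ b → ‖z‖ ≤ R := by
  obtain ⟨r, hr⟩ := hG.isBounded.exists_norm_le
  have hc : ContinuousOn (fun q : ℝ × ℝ ↦ q.1 + V q) G := by fun_prop
  obtain ⟨C, hC⟩ := hG.exists_bound_of_continuousOn hc
  refine ⟨|r| + B * |r| + (2 * (|b| + |C|) + 1), by positivity, ?_⟩
  rintro ⟨x, y, ξ, η⟩ hz hp
  simp only [hamSymbol] at hz hp
  have h1 := hr _ hz
  have h2 := hC _ hz
  rw [Prod.norm_mk, sup_le_iff] at h1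
  simp only [Real.norm_eq_abs] at h1 h2
  obtain ⟨hx, hy⟩ := h1
  have hCb := neg_le_of_abs_le h2
  have e1 := le_abs_self r
  have e2 := le_abs_self C
  have e3 := le_abs_self b
  have e4 : B * |y| ≤ B * |r| := by exact mul_le_mul_of_nonneg_left (hy.trans e1) hB.le
  have sq : ∀ s : ℝ, s ^ 2 ≤ 2 * (|b| + |C|) → |s| ≤ 2 * (|b| + |C|) + 1 := by
    intro s hs
    have := sq_abs s
    nlinarith [sq_nonneg (|s| - 1), abs_nonneg s, abs_nonneg b, abs_nonneg C]
  have f1 := sq (ξ + B * y) (by nlinarith [sq_nonneg η])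
  have f2 := sq η (by nlinarith [sq_nonneg (ξ + B * y)])
  have f3 : |ξ| ≤ |ξ + B * y| + B * |y| := by
    have := abs_sub (ξ + B * y) (B * y)
    rw [add_sub_cancel_right, abs_mul, abs_of_pos hB] at this
    exact this
  have p1 : 0 ≤ B * |r| := by positivity
  have p2 := abs_nonneg r
  have p3 := abs_nonneg b
  have p4 := abs_nonneg C
  simp only [Prod.norm_mk, sup_le_iff, Real.norm_eq_abs]
  refine ⟨?_, ?_, ?_, ?_⟩ <;> linarith

/-- Key existence result. -/
lemma exists_trajectory_well
    (B : ℝ) (hB : 0 < B) (V : ℝ × ℝ → ℝ) (hV : ContDiff ℝ (⊤ : ℕ∞) V) (b : ℝ)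
    (Gint Gext : Set (ℝ × ℝ))
    (hGint : IsCompact Gint) (hGext : IsClosed Gext)
    (hdisj : Gint ∩ Gext = ∅)
    (hsub : {z : ℝ × ℝ | z.1 + V z ≤ b} = Gint ∪ Gext)
    (z : ℝ × ℝ × ℝ × ℝ) (hz : (z.1, z.2.1) ∈ Gint)
    (hp : hamSymbol B V z.1 z.2.1 z.2.2.1 z.2.2.2 ≤ b) :
    ∃ x y ξ η : ℝ → ℝ, IsHamTrajectory B V x y ξ η ∧
        x 0 = z.1 ∧ y 0 = z.2.1 ∧ ξ 0 = z.2.2.1 ∧ η 0 = z.2.2.2 ∧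
        ∀ t : ℝ, (x t, y t) ∈ Gint := by
  obtain ⟨R, hR, hbd⟩ := well_bounded B hB V hV.continuous b Gint hGint
  let χ : ContDiffBump (0 : ℝ × ℝ × ℝ × ℝ) := ⟨R, R + 1, hR, by linarith⟩
  let v : ℝ × ℝ × ℝ × ℝ → ℝ × ℝ × ℝ × ℝ := fun w ↦ χ w • hamField B V w
  have hv : ContDiff ℝ 1 v := χ.contDiff.smul (hamField_contDiff B V hV)
  have hvc : HasCompactSupport v := χ.hasCompactSupport.smul_right
  obtain ⟨K, hK⟩ := hv.lipschitzWith_of_hasCompactSupport hvc (by simp)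
  obtain ⟨L, hL⟩ := hvc.exists_bound_of_continuous hv.continuous
  obtain ⟨γ, hγ0, hγ⟩ := exists_global_curve v K L.toNNReal hK
    (fun w ↦ (hL w).trans (Real.le_coe_toNNReal L)) z
  let x : ℝ → ℝ := fun t ↦ (γ t).1
  let y : ℝ → ℝ := fun t ↦ (γ t).2.1
  let ξ : ℝ → ℝ := fun t ↦ (γ t).2.2.1
  let η : ℝ → ℝ := fun t ↦ (γ t).2.2.2
  have hx : ∀ t, HasDerivAt x (χ (γ t) * (ξ t + B * y t)) t := fun t ↦ (hγ t).fst
  have hy : ∀ t, HasDerivAt y (χ (γ t) * η t) t := fun t ↦ (hγ t).snd.fst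
  have hξ : ∀ t, HasDerivAt ξ (χ (γ t) * (-1 - fderiv ℝ V (x t, y t) (1, 0))) t :=
    fun t ↦ (hγ t).snd.snd.fst
  have hη : ∀ t, HasDerivAt η
      (χ (γ t) * (-B * (ξ t + B * y t) - fderiv ℝ V (x t, y t) (0, 1))) t :=
    fun t ↦ (hγ t).snd.snd.snd
  have hder : ∀ t, HasDerivAt (fun t ↦ hamSymbol B V (x t) (y t) (ξ t) (η t)) 0 t := by
    intro t
    have hVd : HasFDerivAt V (fderiv ℝ V (x t, y t)) (x t, y t) :=
      (hV.differentiable (by simp) _).hasFDerivAt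
    have hV1 := hVd.comp_hasDerivAt t ((hx t).prodMk (hy t))
    have hlin : ∀ p q : ℝ, fderiv ℝ V (x t, y t) (p, q) =
        p * fderiv ℝ V (x t, y t) (1, 0) + q * fderiv ℝ V (x t, y t) (0, 1) := by
      intro p q
      rw [← smul_eq_mul, ← smul_eq_mul, ← map_smul, ← map_smul, ← map_add]
      simp
    rw [hlin] at hV1
    have := ((((((hξ t).add ((hy t).const_mul B)).pow 2).div_const 2).add
      (((hη t).pow 2).div_const 2)).add (hx t)).add hV1
    refine this.congr_deriv ?_
    simp only [Pi.add_apply]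
    push_cast
    ring
  have hE : ∀ t, hamSymbol B V (x t) (y t) (ξ t) (η t) ≤ b := by
    intro t
    have h := is_const_of_deriv_eq_zero (fun s ↦ (hder s).differentiableAt)
      (fun s ↦ (hder s).deriv) t 0
    rw [h]
    simpa only [x, y, ξ, η, hγ0] using hp
  have hcont : Continuous (fun t ↦ (x t, y t)) :=
    continuous_iff_continuousAt.2 fun t ↦ ((hx t).prodMk (hy t)).continuousAt
  have hmem : ∀ t, (x t, y t) ∈ Gint ∪ Gext := by
    intro t
    rw [← hsub]
    have := hE t
    simp only [hamSymbol] at this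
    show x t + V (x t, y t) ≤ b
    nlinarith [sq_nonneg (ξ t + B * y t), sq_nonneg (η t)]
  have hint : ∀ t, (x t, y t) ∈ Gint := by
    have hpre : IsPreconnected (Set.range fun t ↦ (x t, y t)) := isPreconnected_range hcont
    intro t
    rcases hmem t with h | h
    · exact h
    · exfalso
      obtain ⟨q, -, hq⟩ := isPreconnected_closed_iff.1 hpre Gint Gext hGint.isClosed hGext
        (by rintro _ ⟨s, rfl⟩; exact hmem s)
        ⟨_, ⟨0, rfl⟩, by simpa only [x, y, hγ0] using hz⟩ ⟨_, ⟨t, rfl⟩, h⟩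
      rw [hdisj] at hq
      exact hq
  have hone : ∀ t, χ (γ t) = 1 := by
    intro t
    apply χ.one_of_mem_closedBall
    rw [mem_closedBall_zero_iff]
    exact hbd (γ t) (hint t) (hE t)
  refine ⟨x, y, ξ, η, ⟨fun t ↦ ?_, fun t ↦ ?_, fun t ↦ ?_, fun t ↦ ?_⟩, ?_, ?_, ?_, ?_, hint⟩
  · simpa only [hone, one_mul] using hx t
  · simpa only [hone, one_mul] using hy t
  · simpa only [hone, one_mul] using hξ t
  · simpa only [hone, one_mul] using hη t
  all_goals simp only [x, y, ξ, η, hγ0]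

/-- Under the shape resonance assumption (the sublevel set `{x + V ≤ b}` splits
into a compact well `G^int` and a disjoint closed exterior `G^ext`, and no
trapped trajectories over `G^ext`), the trapped set `K_{[a,b]}` is exactly the
part of phase space over the well with energy in `[a, b]`; in particular every
such point lies on a globally defined trajectory staying over `G^int`. -/
theorem trappedSet_eq_well
    (B : ℝ) (hB : 0 < B) (V : ℝ × ℝ → ℝ) (hV : ContDiff ℝ (⊤ : ℕ∞) V)
    (a b : ℝ) (hab : a < b)
    (Gint Gext : Set (ℝ × ℝ))
    (hGint : IsCompact Gint) (hGext : IsClosed Gext)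
    (hdisj : Gint ∩ Gext = ∅)
    (hsub : {z : ℝ × ℝ | z.1 + V z ≤ b} = Gint ∪ Gext)
    (hnotrap : ∀ z ∈ trappedSet B V a b, (z.1, z.2.1) ∉ Gext) :
    trappedSet B V a b =
      {z : ℝ × ℝ × ℝ × ℝ | (z.1, z.2.1) ∈ Gint ∧
        a ≤ hamSymbol B V z.1 z.2.1 z.2.2.1 z.2.2.2 ∧
        hamSymbol B V z.1 z.2.1 z.2.2.1 z.2.2.2 ≤ b} ∧
    ∀ z : ℝ × ℝ × ℝ × ℝ, (z.1, z.2.1) ∈ Gint →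
      a ≤ hamSymbol B V z.1 z.2.1 z.2.2.1 z.2.2.2 →
      hamSymbol B V z.1 z.2.1 z.2.2.1 z.2.2.2 ≤ b →
      ∃ x y ξ η : ℝ → ℝ, IsHamTrajectory B V x y ξ η ∧
        x 0 = z.1 ∧ y 0 = z.2.1 ∧ ξ 0 = z.2.2.1 ∧ η 0 = z.2.2.2 ∧
        ∀ t : ℝ, (x t, y t) ∈ Gint := by
  have main := exists_trajectory_well B hB V hV b Gint Gext hGint hGext hdisj hsub
  refine ⟨?_, fun z hz _ hp ↦ main z hz hp⟩
  ext z
  constructor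
  · intro hz
    refine ⟨?_, hz.1, hz.2.1⟩
    have hm : (z.1, z.2.1) ∈ Gint ∪ Gext := by
      rw [← hsub]
      have := hz.2.1
      simp only [hamSymbol] at this
      show z.1 + V (z.1, z.2.1) ≤ b
      nlinarith [sq_nonneg (z.2.2.1 + B * z.2.1), sq_nonneg z.2.2.2]
    exact hm.resolve_right (hnotrap z hz)
  · rintro ⟨hz, ha, hp⟩
    obtain ⟨x, y, ξ, η, h, h1, h2, h3, h4, h5⟩ := main z hz hp
    obtain ⟨C, hC⟩ := hGint.isBounded.exists_norm_le
    exact ⟨ha, hp, x, y, ξ, η, h, h1, h2, h3, h4, C, fun t ↦ hC _ (h5 t)⟩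
end
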